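/- There exists an absolute constant C such that for every set P of m points in ℝ² and every set L of n distinct lines in ℝ², the number of incidences I(P, L) is at most C·( m^{2/3}·n^{2/3} + m + n ). -/

import Mathlib

/-- Two affine functions without a common value strictly between `m` and `x` do not swap order
on the way from `x` to `m`. -/
lemma affine_le_of_lt_of_forall_ne {s c s' c' m x : ℝ} (hmx : m < x)
    (hx : s * x + c < s' * x + c')
    (hne : ∀ z, m < z → z < x → s * z + c ≠ s' * z + c') :
    s * m + c ≤ s' * m + c' := by
  by_contra! hm
  have hcont : ContinuousOn (fun z => (s' * z + c') - (s * z + c)) (Set.Icc m x) := by fun_prop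
  obtain ⟨z, hz, h0⟩ := intermediate_value_Ioo hmx.le hcont
    (show (0 : ℝ) ∈ Set.Ioo _ _ from ⟨by linarith, by linarith⟩)
  exact hne z hz.1 hz.2 (by simp only at h0; linarith)

/-- A straight-line drawing of a graph without crossings: the vertices are the points `(v, Y v)`
with `v ∈ S`, and the edge `e ∈ E` joins the vertices over `l e < r e` along the line
`y = s e * x + c e`. -/
structure IsPlaneDrawing {ι : Type*} (E : Finset ι) (S : Finset ℝ) (Y : ℝ → ℝ)
    (s c l r : ι → ℝ) : Prop where
  left_mem : ∀ e ∈ E, l e ∈ S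
  right_mem : ∀ e ∈ E, r e ∈ S
  left_lt_right : ∀ e ∈ E, l e < r e
  left_on : ∀ e ∈ E, s e * l e + c e = Y (l e)
  right_on : ∀ e ∈ E, s e * r e + c e = Y (r e)
  vertex_notMem : ∀ e ∈ E, ∀ v ∈ S, l e < v → v < r e → s e * v + c e ≠ Y v
  noncrossing : ∀ e ∈ E, ∀ f ∈ E, e ≠ f → ∀ x, l e < x → x < r e → l f < x → x < r f →
    s e * x + c e ≠ s f * x + c f

namespace IsPlaneDrawing

variable {ι : Type*} {E : Finset ι} {S : Finset ℝ} {Y : ℝ → ℝ} {s c l r : ι → ℝ}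

/-- The edge `e'` follows `e` in the order by slope of the edges leaving their common left end. -/
def Next (E : Finset ι) (s l : ι → ℝ) (e e' : ι) : Prop :=
  e' ∈ E ∧ l e' = l e ∧ s e < s e' ∧ ∀ f ∈ E, l f = l e → s e < s f → s e' ≤ s f

/-- The vertex `w` is the leftmost one in the wedge between `e` and `e'`. -/
def Sees (S : Finset ℝ) (Y : ℝ → ℝ) (s c l r : ι → ℝ) (e e' : ι) (w : ℝ) : Prop :=
  w ∈ S ∧ l e < w ∧ w ≤ r e ∧ w ≤ r e' ∧ s e * w + c e ≤ Y w ∧ Y w ≤ s e' * w + c e' ∧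
    ∀ v ∈ S, l e < v → v < w → s e * v + c e ≤ Y v → Y v ≤ s e' * v + c e' → False

lemma eq_of_left_eq_of_slope_eq (h : IsPlaneDrawing E S Y s c l r) {e f : ι} (he : e ∈ E)
    (hf : f ∈ E) (hl : l e = l f) (hs : s e = s f) : e = f := by
  by_contra hef
  obtain ⟨x, hx, hx'⟩ := exists_between
    (lt_min (h.left_lt_right e he) (hl ▸ h.left_lt_right f hf))
  have h1 := h.left_on e he
  have h2 := h.left_on f hf
  rw [lt_min_iff] at hx'
  refine h.noncrossing e he f hf hef x hx hx'.1 (hl ▸ hx) hx'.2 ?_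
  rw [hl, hs] at h1
  rw [hs]
  linarith

lemma exists_sees (h : IsPlaneDrawing E S Y s c l r) {e e' : ι} (he : e ∈ E)
    (hn : Next E s l e e') : ∃ w, Sees S Y s c l r e e' w := by
  classical
  obtain ⟨he', hl, hs, -⟩ := hn
  have h1 := h.left_on e he
  have h2 := h.left_on e' he'
  rw [hl] at h2
  have hle : ∀ x, l e ≤ x → s e * x + c e ≤ s e' * x + c e' := by
    intro x hx
    nlinarith
  let W := S.filter fun v => l e < v ∧ v ≤ r e ∧ v ≤ r e' ∧ s e * v + c e ≤ Y v ∧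
    Y v ≤ s e' * v + c e'
  have hr := h.left_lt_right e he
  have hr' := h.left_lt_right e' he'
  have hW : W.Nonempty := by
    rcases le_total (r e) (r e') with hrr | hrr
    · refine ⟨r e, Finset.mem_filter.2 ⟨h.right_mem e he, hr, le_rfl, hrr, ?_⟩⟩
      rw [← h.right_on e he]
      exact ⟨le_rfl, hle _ hr.le⟩
    · refine ⟨r e', Finset.mem_filter.2 ⟨h.right_mem e' he', hl ▸ hr', hrr, le_rfl, ?_⟩⟩
      rw [← h.right_on e' he']
      exact ⟨hle _ (hl ▸ hr'.le), le_rfl⟩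
  obtain ⟨hS, h3, h4, h5, h6, h7⟩ := Finset.mem_filter.1 (W.min'_mem hW)
  refine ⟨W.min' hW, hS, h3, h4, h5, h6, h7, fun v hv hlv hvw hv1 hv2 => ?_⟩
  exact (W.min'_le v (Finset.mem_filter.2 ⟨hv, hlv, hvw.le.trans h4, hvw.le.trans h5, hv1,
    hv2⟩)).not_gt hvw

/-- No edge passes strictly between consecutive edges to the left of the vertex they see. -/
lemma not_between (h : IsPlaneDrawing E S Y s c l r) {e e' f : ι} (he : e ∈ E) (hf : f ∈ E)
    (hn : Next E s l e e') {w : ℝ} (hw : Sees S Y s c l r e e' w) {x : ℝ} (hxw : x ≤ w)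
    (hex : l e < x) (hfx : l f < x) (hxf : x < r f) (h1 : s e * x + c e < s f * x + c f)
    (h2 : s f * x + c f < s e' * x + c e') : False := by
  obtain ⟨he', hl, hs, hmin⟩ := hn
  obtain ⟨-, -, hwr, hwr', -, -, hleft⟩ := hw
  have hlo : s e * max (l e) (l f) + c e ≤ s f * max (l e) (l f) + c f := by
    refine affine_le_of_lt_of_forall_ne (max_lt hex hfx) h1 fun z hz hzx => ?_
    rw [max_lt_iff] at hz
    refine h.noncrossing e he f hf ?_ z hz.1 (by linarith) hz.2 (by linarith)
    rintro rfl
    exact lt_irrefl _ h1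
  have hhi : s f * max (l e) (l f) + c f ≤ s e' * max (l e) (l f) + c e' := by
    refine affine_le_of_lt_of_forall_ne (max_lt hex hfx) h2 fun z hz hzx => ?_
    rw [max_lt_iff] at hz
    refine h.noncrossing f hf e' he' ?_ z hz.2 (by linarith) (hl ▸ hz.1) (by linarith)
    rintro rfl
    exact lt_irrefl _ h2
  have hYe := h.left_on e he
  have hYe' := h.left_on e' he'
  have hYf := h.left_on f hf
  rw [hl] at hYe'
  rcases lt_trichotomy (l e) (l f) with hlt | heq | hgt
  · rw [max_eq_right hlt.le] at hlo hhi
    exact hleft (l f) (h.left_mem f hf) hlt (by linarith) (by linarith) (by linarith)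
  · rw [← heq] at hYf
    have h3 : s e < s f := by nlinarith
    have h4 : s f < s e' := by nlinarith
    exact (hmin f hf heq.symm h3).not_gt h4
  · rw [max_eq_left hgt.le] at hlo hhi
    exact h.vertex_notMem f hf (l e) (h.left_mem e he) hgt (by linarith) (by linarith)

/-- Edges passing strictly below a vertex which they see are equal. -/
lemma eq_of_sees_above (h : IsPlaneDrawing E S Y s c l r) {e e' f f' : ι} (he : e ∈ E)
    (hf : f ∈ E) (hn : Next E s l e e') (hn' : Next E s l f f') {w : ℝ}
    (hw : Sees S Y s c l r e e' w) (hw' : Sees S Y s c l r f f' w) (hne : w ≠ r e)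
    (hnf : w ≠ r f) : e = f := by
  by_contra hef
  obtain ⟨hS, hew, hwe, -, hY, hY', -⟩ := id hw
  obtain ⟨-, hfw, hwf, -, hZ, hZ', -⟩ := id hw'
  have hwe := hwe.lt_of_ne hne
  have hwf := hwf.lt_of_ne hnf
  have hY := hY.lt_of_ne (h.vertex_notMem e he w hS hew hwe)
  have hZ := hZ.lt_of_ne (h.vertex_notMem f hf w hS hfw hwf)
  rcases lt_or_gt_of_ne (h.noncrossing e he f hf hef w hew hwe hfw hwf) with hlt | hgt
  · exact h.not_between he hf hn hw le_rfl hew hfw hwf hlt (by linarith)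
  · exact h.not_between hf he hn' hw' le_rfl hfw hew hwe hgt (by linarith)

lemma slope_le_of_sees_right (h : IsPlaneDrawing E S Y s c l r) {e e' f : ι} (he : e ∈ E)
    (hf : f ∈ E) (hn : Next E s l e e') {w : ℝ} (hw : Sees S Y s c l r e e' w)
    (hwe : w = r e) (hwf : w = r f) : s e ≤ s f := by
  by_contra! hlt
  obtain ⟨hS, hew, -, hwe', -, hY', -⟩ := id hw
  obtain ⟨he', hl, hs, -⟩ := id hn
  have hfw : l f < w := hwf ▸ h.left_lt_right f hf
  have hre := h.right_on e he
  have hrf := h.right_on f hf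
  rw [← hwe] at hre
  rw [← hwf] at hrf
  have hle := h.left_on e he
  have hle' := h.left_on e' he'
  rw [hl] at hle'
  have hgt : Y w < s e' * w + c e' := by nlinarith
  have hfe' : f ≠ e' := by
    rintro rfl
    linarith
  obtain ⟨x, hx, hxw⟩ := exists_between (max_lt hew hfw)
  rw [max_lt_iff] at hx
  have h2 : s f * x + c f ≤ s e' * x + c e' := by
    refine affine_le_of_lt_of_forall_ne hxw (by linarith) fun z hxz hzw => ?_
    exact h.noncrossing f hf e' he' hfe' z (by linarith) (by linarith) (by linarith)
      (by linarith)
  refine h.not_between he hf hn hw hxw.le hx.1 hx.2 (hwf ▸ hxw) (by nlinarith) ?_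
  exact h2.lt_of_ne (h.noncrossing f hf e' he' hfe' x hx.2 (by linarith) (hl ▸ hx.1)
    (by linarith))

/-- Edges ending at a vertex which they see are equal. -/
lemma eq_of_sees_right (h : IsPlaneDrawing E S Y s c l r) {e e' f f' : ι} (he : e ∈ E)
    (hf : f ∈ E) (hn : Next E s l e e') (hn' : Next E s l f f') {w : ℝ}
    (hw : Sees S Y s c l r e e' w) (hw' : Sees S Y s c l r f f' w) (hwe : w = r e)
    (hwf : w = r f) : e = f := by
  by_contra hef
  have hs := (h.slope_le_of_sees_right he hf hn hw hwe hwf).antisymm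
    (h.slope_le_of_sees_right hf he hn' hw' hwf hwe)
  have hre := h.right_on e he
  have hrf := h.right_on f hf
  obtain ⟨x, hx, hxw⟩ := exists_between (max_lt hw.2.1 hw'.2.1)
  rw [max_lt_iff] at hx
  refine h.noncrossing e he f hf hef x hx.1 (hwe ▸ hxw) hx.2 (hwf ▸ hxw) ?_
  rw [← hwe] at hre
  rw [← hwf] at hrf
  rw [hs] at hre ⊢
  linarith

lemma exists_next {e f : ι} (hf : f ∈ E)
    (hl : l f = l e) (hs : s e < s f) : ∃ e', Next E s l e e' := by
  classical
  obtain ⟨e', he', hmin⟩ := (E.filter fun f => l f = l e ∧ s e < s f).exists_min_image s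
    ⟨f, Finset.mem_filter.2 ⟨hf, hl, hs⟩⟩
  obtain ⟨h1, h2, h3⟩ := Finset.mem_filter.1 he'
  exact ⟨e', h1, h2, h3, fun g hg hgl hgs => hmin g (Finset.mem_filter.2 ⟨hg, hgl, hgs⟩)⟩

/-- A plane straight-line graph has at most three times as many edges as vertices. -/
theorem card_le (h : IsPlaneDrawing E S Y s c l r) : E.card ≤ 3 * S.card := by
  classical
  have hnext : ∀ e ∈ E, (∃ f ∈ E, l f = l e ∧ s e < s f) →
      ∃ w e', Next E s l e e' ∧ Sees S Y s c l r e e' w := by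
    rintro e he ⟨f, hf, hl, hs⟩
    obtain ⟨e', hn⟩ := exists_next hf hl hs
    obtain ⟨w, hw⟩ := h.exists_sees he hn
    exact ⟨w, e', hn, hw⟩
  let A := E.filter fun e => ∃ f ∈ E, l f = l e ∧ s e < s f
  let B := E.filter fun e => ¬∃ f ∈ E, l f = l e ∧ s e < s f
  choose! φ hφ using hnext
  let A₁ := A.filter fun e => φ e = r e
  let A₂ := A.filter fun e => ¬φ e = r e
  have hA : A₁.card + A₂.card = A.card := Finset.card_filter_add_card_filter_not _
  have hE : A.card + B.card = E.card := Finset.card_filter_add_card_filter_not _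
  have hA₁ : A₁.card ≤ S.card := by
    refine Finset.card_le_card_of_injOn φ (fun e he => ?_) fun e he f hf hef => ?_
    · simp only [A₁, A, Finset.mem_coe, Finset.mem_filter] at he
      obtain ⟨e', hn, hw⟩ := hφ e he.1.1 he.1.2
      exact hw.1
    · simp only [A₁, A, Finset.mem_coe, Finset.mem_filter] at he hf
      obtain ⟨e', hn, hw⟩ := hφ e he.1.1 he.1.2
      obtain ⟨f', hn', hw'⟩ := hφ f hf.1.1 hf.1.2
      exact h.eq_of_sees_right he.1.1 hf.1.1 hn hn' hw (hef ▸ hw') he.2 (hef ▸ hf.2)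
  have hA₂ : A₂.card ≤ S.card := by
    refine Finset.card_le_card_of_injOn φ (fun e he => ?_) fun e he f hf hef => ?_
    · simp only [A₂, A, Finset.mem_coe, Finset.mem_filter] at he
      obtain ⟨e', hn, hw⟩ := hφ e he.1.1 he.1.2
      exact hw.1
    · simp only [A₂, A, Finset.mem_coe, Finset.mem_filter] at he hf
      obtain ⟨e', hn, hw⟩ := hφ e he.1.1 he.1.2
      obtain ⟨f', hn', hw'⟩ := hφ f hf.1.1 hf.1.2
      exact h.eq_of_sees_above he.1.1 hf.1.1 hn hn' hw (hef ▸ hw') he.2 (hef ▸ hf.2)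
  have hB : B.card ≤ S.card := by
    refine Finset.card_le_card_of_injOn l (fun e he => ?_) fun e he f hf hef => ?_
    · exact h.left_mem e (Finset.mem_filter.1 he).1
    · obtain ⟨he, he'⟩ := Finset.mem_filter.1 he
      obtain ⟨hf, hf'⟩ := Finset.mem_filter.1 hf
      refine h.eq_of_left_eq_of_slope_eq he hf hef (le_antisymm ?_ ?_)
      · by_contra! hlt
        exact hf' ⟨e, he, hef, hlt⟩
      · by_contra! hlt
        exact he' ⟨f, hf, hef.symm, hlt⟩
  omega

end IsPlaneDrawing

section Sampling

variable {α : Type*} [DecidableEq α]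

/-- The probability that a random subset `S` of `V`, containing each element independently with
probability `p`, contains `T`. -/
lemma sum_powerset_weight_of_subset {V T : Finset α} (hT : T ⊆ V) (p : ℝ) :
    ∑ S ∈ V.powerset, p ^ S.card * (1 - p) ^ (V \ S).card * (if T ⊆ S then 1 else 0) =
      p ^ T.card := by
  have h := Finset.prod_add (fun _ : α => p) (fun i => if i ∈ T then 0 else 1 - p) V
  have hprod : ∏ i ∈ V, (p + if i ∈ T then 0 else 1 - p) = p ^ T.card := by
    rw [← Finset.prod_subset hT (f := fun i => p + if i ∈ T then 0 else 1 - p)]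
    · rw [← Finset.prod_const]
      exact Finset.prod_congr rfl fun i hi => by simp [hi]
    · intro i _ hi
      simp [hi]
  rw [← hprod, h]
  refine Finset.sum_congr rfl fun S hS => ?_
  rw [Finset.prod_const, mul_assoc]
  congr 1
  split_ifs with hTS
  · rw [mul_one, ← Finset.prod_const]
    refine Finset.prod_congr rfl fun i hi => ?_
    rw [if_neg fun hiT => (Finset.mem_sdiff.1 hi).2 (hTS hiT)]
  · obtain ⟨i, hi, hiS⟩ := Finset.not_subset.1 hTS
    rw [mul_zero]
    exact (Finset.prod_eq_zero (Finset.mem_sdiff.2 ⟨hT hi, hiS⟩) (by simp [hi])).symm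

/-- The expected number of sets `T i` contained in a random subset of `V`. -/
lemma sum_powerset_weight_mul_card {ι : Type*} {V : Finset α} {k : ℕ} (I : Finset ι)
    (T : ι → Finset α) (hT : ∀ i ∈ I, T i ⊆ V) (hk : ∀ i ∈ I, (T i).card = k) (p : ℝ) :
    ∑ S ∈ V.powerset, p ^ S.card * (1 - p) ^ (V \ S).card * ((I.filter (T · ⊆ S)).card : ℝ) =
      p ^ k * I.card := by
  have hcard : ∀ S, ((I.filter (T · ⊆ S)).card : ℝ) = ∑ i ∈ I, if T i ⊆ S then 1 else 0 := by
    intro S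
    rw [Finset.card_filter]
    push_cast
    rfl
  simp_rw [hcard, Finset.mul_sum]
  rw [Finset.sum_comm, Finset.sum_congr rfl fun i hi =>
    (sum_powerset_weight_of_subset (hT i hi) p).trans (by rw [hk i hi]), Finset.sum_const,
    nsmul_eq_mul, mul_comm]

/-- The amplification step of the crossing lemma: a linear bound for the number of edges induced
on every vertex set, with one unit of loss per crossing, improves to a cubic one. -/
lemma card_le_or_card_pow_three_le {ι κ : Type*} {V : Finset α} {E : Finset ι} {X : Finset κ}
    {T : ι → Finset α} {U : κ → Finset α} (hT : ∀ e ∈ E, T e ⊆ V)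
    (hT2 : ∀ e ∈ E, (T e).card = 2) (hU : ∀ x ∈ X, U x ⊆ V) (hU4 : ∀ x ∈ X, (U x).card = 4)
    (h : ∀ S ⊆ V, (E.filter (T · ⊆ S)).card ≤ 3 * S.card + (X.filter (U · ⊆ S)).card) :
    (E.card : ℝ) ≤ 6 * V.card ∨ (E.card : ℝ) ^ 3 ≤ 72 * (V.card : ℝ) ^ 2 * X.card := by
  have key : ∀ p : ℝ, 0 ≤ p → p ≤ 1 →
      p ^ 2 * E.card ≤ 3 * (p * V.card) + p ^ 4 * X.card := by
    intro p hp0 hp1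
    rw [← sum_powerset_weight_mul_card E T hT hT2 p, ← sum_powerset_weight_mul_card X U hU hU4 p]
    have hV := sum_powerset_weight_mul_card (k := 1) V (fun v => {v})
      (fun v hv => Finset.singleton_subset_iff.2 hv) (fun v _ => Finset.card_singleton v) p
    rw [pow_one] at hV
    rw [← hV, Finset.mul_sum, ← Finset.sum_add_distrib]
    refine Finset.sum_le_sum fun S hS => ?_
    have hfilter : V.filter (fun v => {v} ⊆ S) = S := by
      ext v
      simpa using fun hv => Finset.mem_powerset.1 hS hv
    rw [hfilter]
    have hw : 0 ≤ p ^ S.card * (1 - p) ^ (V \ S).card :=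
      mul_nonneg (pow_nonneg hp0 _) (pow_nonneg (sub_nonneg.2 hp1) _)
    have hS' : ((E.filter (T · ⊆ S)).card : ℝ) ≤ 3 * S.card + (X.filter (U · ⊆ S)).card :=
      mod_cast h S (Finset.mem_powerset.1 hS)
    nlinarith [mul_le_mul_of_nonneg_left hS' hw]
  rw [or_iff_not_imp_left]
  intro hlt
  rw [not_le] at hlt
  have hv : (0 : ℝ) ≤ V.card := Nat.cast_nonneg _
  have he : (0 : ℝ) < E.card := by linarith
  rcases hv.eq_or_lt with hv0 | hv0
  · have hV : V = ∅ := Finset.card_eq_zero.1 (by exact_mod_cast hv0.symm)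
    obtain ⟨e, heE⟩ := Finset.card_pos.1 (by exact_mod_cast he)
    have h0 := hT e heE
    rw [hV, Finset.subset_empty] at h0
    simpa [h0] using hT2 e heE
  have hp := key (6 * V.card / E.card) (by positivity) ((div_le_one he).2 hlt.le)
  generalize (E.card : ℝ) = e at *
  generalize (V.card : ℝ) = v at *
  generalize (X.card : ℝ) = x at *
  have h1 : (6 * v / e) ^ 2 * e = 36 * v ^ 2 * e ^ 3 / e ^ 4 := by field_simp; norm_num
  have h2 : 3 * (6 * v / e * v) + (6 * v / e) ^ 4 * x =
      (18 * v ^ 2 * e ^ 3 + 1296 * v ^ 4 * x) / e ^ 4 := by field_simp; ring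
  rw [h1, h2, div_le_div_iff_of_pos_right (by positivity)] at hp
  have h3 : (18 * v ^ 2) * e ^ 3 ≤ (18 * v ^ 2) * (72 * v ^ 2 * x) := by linarith
  exact le_of_mul_le_mul_left h3 (by positivity)

end Sampling

section Lines

open Classical in
/-- The segments cut out of the lines `y = ℓ.1 * x + ℓ.2`, `ℓ ∈ L`, by consecutive points among
the `(v, Y v)`, `v ∈ V`. -/
noncomputable def lineSegments (V : Finset ℝ) (Y : ℝ → ℝ) (L : Finset (ℝ × ℝ)) :
    Finset ((ℝ × ℝ) × (ℝ × ℝ)) :=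
  (L ×ˢ (V ×ˢ V)).filter fun e => e.2.1 < e.2.2 ∧ e.1.1 * e.2.1 + e.1.2 = Y e.2.1 ∧
    e.1.1 * e.2.2 + e.1.2 = Y e.2.2 ∧
      ∀ v ∈ V, e.2.1 < v → v < e.2.2 → e.1.1 * v + e.1.2 ≠ Y v

open Classical in
/-- The ordered pairs of distinct segments with a common interior point. -/
noncomputable def lineCrossings (V : Finset ℝ) (Y : ℝ → ℝ) (L : Finset (ℝ × ℝ)) :
    Finset (((ℝ × ℝ) × (ℝ × ℝ)) × ((ℝ × ℝ) × (ℝ × ℝ))) :=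
  (lineSegments V Y L ×ˢ lineSegments V Y L).filter fun x => x.1 ≠ x.2 ∧
    ∃ z, x.1.2.1 < z ∧ z < x.1.2.2 ∧ x.2.2.1 < z ∧ z < x.2.2.2 ∧
      x.1.1.1 * z + x.1.1.2 = x.2.1.1 * z + x.2.1.2

variable {V : Finset ℝ} {Y : ℝ → ℝ} {L : Finset (ℝ × ℝ)}

lemma mem_lineSegments {e : (ℝ × ℝ) × (ℝ × ℝ)} : e ∈ lineSegments V Y L ↔
    (e.1 ∈ L ∧ e.2.1 ∈ V ∧ e.2.2 ∈ V) ∧ e.2.1 < e.2.2 ∧ e.1.1 * e.2.1 + e.1.2 = Y e.2.1 ∧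
      e.1.1 * e.2.2 + e.1.2 = Y e.2.2 ∧
        ∀ v ∈ V, e.2.1 < v → v < e.2.2 → e.1.1 * v + e.1.2 ≠ Y v := by
  simp only [lineSegments, Finset.mem_filter, Finset.mem_product]

lemma mem_lineCrossings {x : ((ℝ × ℝ) × (ℝ × ℝ)) × ((ℝ × ℝ) × (ℝ × ℝ))} :
    x ∈ lineCrossings V Y L ↔ (x.1 ∈ lineSegments V Y L ∧ x.2 ∈ lineSegments V Y L) ∧
      x.1 ≠ x.2 ∧ ∃ z, x.1.2.1 < z ∧ z < x.1.2.2 ∧ x.2.2.1 < z ∧ z < x.2.2.2 ∧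
        x.1.1.1 * z + x.1.1.2 = x.2.1.1 * z + x.2.1.2 := by
  simp only [lineCrossings, Finset.mem_filter, Finset.mem_product]

/-- Segments of one line with a common interior point are equal. -/
lemma eq_of_mem_lineSegments {e f : (ℝ × ℝ) × (ℝ × ℝ)} (he : e ∈ lineSegments V Y L)
    (hf : f ∈ lineSegments V Y L) (hl : e.1 = f.1) {z : ℝ} (h1 : e.2.1 < z) (h2 : z < e.2.2)
    (h3 : f.2.1 < z) (h4 : z < f.2.2) : e = f := by
  obtain ⟨⟨-, hea, heb⟩, -, hYa, hYb, hno⟩ := mem_lineSegments.1 he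
  obtain ⟨⟨-, hfa, hfb⟩, -, hZa, hZb, hno'⟩ := mem_lineSegments.1 hf
  rw [← hl] at hZa hZb hno'
  refine Prod.ext hl (Prod.ext ?_ ?_)
  · rcases lt_trichotomy e.2.1 f.2.1 with h | h | h
    · exact absurd hZa (hno _ hfa h (h3.trans h2))
    · exact h
    · exact absurd hYa (hno' _ hea h (h1.trans h4))
  · rcases lt_trichotomy e.2.2 f.2.2 with h | h | h
    · exact absurd hYb (hno' _ heb (h3.trans h2) h)
    · exact h
    · exact absurd hZb (hno _ hfb (h1.trans h4) h)

/-- Distinct non-vertical lines meet over at most one abscissa. -/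
lemma eq_of_two_intersections {ℓ ℓ' : ℝ × ℝ} (hne : ℓ ≠ ℓ') {x y : ℝ}
    (hx : ℓ.1 * x + ℓ.2 = ℓ'.1 * x + ℓ'.2) (hy : ℓ.1 * y + ℓ.2 = ℓ'.1 * y + ℓ'.2) : x = y := by
  by_contra hxy
  have h1 : (ℓ.1 - ℓ'.1) * (x - y) = 0 := by linarith
  have h2 : ℓ.1 = ℓ'.1 := by
    rcases mul_eq_zero.1 h1 with h | h
    · linarith
    · exact absurd (sub_eq_zero.1 h) hxy
  refine hne (Prod.ext h2 ?_)
  rw [h2] at hx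
  linarith

lemma line_ne_of_mem_lineCrossings {x : ((ℝ × ℝ) × (ℝ × ℝ)) × ((ℝ × ℝ) × (ℝ × ℝ))}
    (hx : x ∈ lineCrossings V Y L) : x.1.1 ≠ x.2.1 := by
  obtain ⟨⟨he, hf⟩, hne, z, h1, h2, h3, h4, -⟩ := mem_lineCrossings.1 hx
  exact fun hl => hne (eq_of_mem_lineSegments he hf hl h1 h2 h3 h4)

lemma card_lineCrossings_le : (lineCrossings V Y L).card ≤ L.card ^ 2 := by
  rw [sq, ← Finset.card_product]
  refine Finset.card_le_card_of_injOn (fun x => (x.1.1, x.2.1)) (fun x hx => ?_)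
    fun x hx y hy hxy => ?_
  · obtain ⟨⟨he, hf⟩, -⟩ := mem_lineCrossings.1 hx
    exact Finset.mem_product.2 ⟨(mem_lineSegments.1 he).1.1, (mem_lineSegments.1 hf).1.1⟩
  · have hne := line_ne_of_mem_lineCrossings hx
    obtain ⟨⟨he, hf⟩, -, z, h1, h2, h3, h4, hz⟩ := mem_lineCrossings.1 hx
    obtain ⟨⟨he', hf'⟩, -, z', h1', h2', h3', h4', hz'⟩ := mem_lineCrossings.1 hy
    obtain ⟨hxy1, hxy2⟩ := Prod.mk.inj hxy
    rw [← hxy1, ← hxy2] at hz'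
    obtain rfl := eq_of_two_intersections hne hz hz'
    exact Prod.ext (eq_of_mem_lineSegments he he' hxy1 h1 h2 h1' h2')
      (eq_of_mem_lineSegments hf hf' hxy2 h3 h4 h3' h4')

/-- The ends of two crossing segments are four distinct points. -/
lemma card_ends_of_mem_lineCrossings {x : ((ℝ × ℝ) × (ℝ × ℝ)) × ((ℝ × ℝ) × (ℝ × ℝ))}
    (hx : x ∈ lineCrossings V Y L) :
    ({x.1.2.1, x.1.2.2, x.2.2.1, x.2.2.2} : Finset ℝ).card = 4 := by
  have hne := line_ne_of_mem_lineCrossings hx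
  obtain ⟨⟨he, hf⟩, -, z, h1, h2, h3, h4, hz⟩ := mem_lineCrossings.1 hx
  obtain ⟨-, -, hYa, hYb, -⟩ := mem_lineSegments.1 he
  obtain ⟨-, -, hZa, hZb, -⟩ := mem_lineSegments.1 hf
  have hz' : ∀ w, x.1.1.1 * w + x.1.1.2 = Y w → x.2.1.1 * w + x.2.1.2 = Y w → w = z :=
    fun w hw hw' => eq_of_two_intersections hne (hw.trans hw'.symm) hz
  have h5 : x.1.2.1 ≠ x.1.2.2 := (h1.trans h2).ne
  have h6 : x.1.2.1 ≠ x.2.2.1 := fun h => h1.ne (hz' _ hYa (h ▸ hZa))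
  have h7 : x.1.2.1 ≠ x.2.2.2 := fun h => h1.ne (hz' _ hYa (h ▸ hZb))
  have h8 : x.1.2.2 ≠ x.2.2.1 := fun h => h2.ne' (hz' _ hYb (h ▸ hZa))
  have h9 : x.1.2.2 ≠ x.2.2.2 := fun h => h2.ne' (hz' _ hYb (h ▸ hZb))
  have h10 : x.2.2.1 ≠ x.2.2.2 := (h3.trans h4).ne
  rw [Finset.card_insert_of_notMem (by simp [h5, h6, h7]),
    Finset.card_insert_of_notMem (by simp [h8, h9]), Finset.card_pair h10]

/-- Deleting one segment from each crossing leaves a plane drawing. -/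
lemma card_lineSegments_filter_le {S : Finset ℝ} (hS : S ⊆ V) :
    ((lineSegments V Y L).filter fun e => ({e.2.1, e.2.2} : Finset ℝ) ⊆ S).card ≤ 3 * S.card +
      ((lineCrossings V Y L).filter fun x =>
        ({x.1.2.1, x.1.2.2, x.2.2.1, x.2.2.2} : Finset ℝ) ⊆ S).card := by
  classical
  set E := (lineSegments V Y L).filter fun e => ({e.2.1, e.2.2} : Finset ℝ) ⊆ S
  set X := (lineCrossings V Y L).filter fun x =>
    ({x.1.2.1, x.1.2.2, x.2.2.1, x.2.2.2} : Finset ℝ) ⊆ S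
  have hmem : ∀ e ∈ E \ X.image Prod.fst,
      e ∈ lineSegments V Y L ∧ e.2.1 ∈ S ∧ e.2.2 ∈ S := by
    intro e he
    obtain ⟨h1, h2⟩ := Finset.mem_filter.1 (Finset.mem_sdiff.1 he).1
    simp only [Finset.insert_subset_iff, Finset.singleton_subset_iff] at h2
    exact ⟨h1, h2⟩
  have hplane : IsPlaneDrawing (E \ X.image Prod.fst) S Y (fun e => e.1.1) (fun e => e.1.2)
      (fun e => e.2.1) (fun e => e.2.2) :=
    { left_mem := fun e he => (hmem e he).2.1
      right_mem := fun e he => (hmem e he).2.2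
      left_lt_right := fun e he => (mem_lineSegments.1 (hmem e he).1).2.1
      left_on := fun e he => (mem_lineSegments.1 (hmem e he).1).2.2.1
      right_on := fun e he => (mem_lineSegments.1 (hmem e he).1).2.2.2.1
      vertex_notMem := fun e he v hv =>
        (mem_lineSegments.1 (hmem e he).1).2.2.2.2 v (hS hv)
      noncrossing := by
        intro e he f hf hne z h1 h2 h3 h4 hz
        refine (Finset.mem_sdiff.1 he).2 (Finset.mem_image.2 ⟨(e, f), ?_, rfl⟩)
        refine Finset.mem_filter.2 ⟨mem_lineCrossings.2
          ⟨⟨(hmem e he).1, (hmem f hf).1⟩, hne, z, h1, h2, h3, h4, hz⟩, ?_⟩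
        simp only [Finset.insert_subset_iff, Finset.singleton_subset_iff]
        exact ⟨(hmem e he).2.1, (hmem e he).2.2, (hmem f hf).2⟩ }
  have h1 := hplane.card_le
  have h2 : (X.image Prod.fst).card ≤ X.card := Finset.card_image_le
  have h3 := Finset.le_card_sdiff (X.image Prod.fst) E
  omega

lemma card_lineSegments_le_or :
    ((lineSegments V Y L).card : ℝ) ≤ 6 * V.card ∨
      ((lineSegments V Y L).card : ℝ) ^ 3 ≤ 72 * (V.card : ℝ) ^ 2 * (L.card : ℝ) ^ 2 := by
  refine (card_le_or_card_pow_three_le (V := V) (E := lineSegments V Y L)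
    (X := lineCrossings V Y L) (T := fun e => {e.2.1, e.2.2})
    (U := fun x => {x.1.2.1, x.1.2.2, x.2.2.1, x.2.2.2}) (fun e he => ?_) (fun e he => ?_)
    (fun x hx => ?_) (fun x hx => card_ends_of_mem_lineCrossings hx)
    (fun S hS => card_lineSegments_filter_le hS)).imp_right
    fun h => ?_
  · simp only [Finset.insert_subset_iff, Finset.singleton_subset_iff]
    exact (mem_lineSegments.1 he).1.2
  · exact Finset.card_pair (mem_lineSegments.1 he).2.1.ne
  · obtain ⟨⟨he, hf⟩, -⟩ := mem_lineCrossings.1 hx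
    simp only [Finset.insert_subset_iff, Finset.singleton_subset_iff]
    exact ⟨(mem_lineSegments.1 he).1.2.1, (mem_lineSegments.1 he).1.2.2,
      (mem_lineSegments.1 hf).1.2⟩
  · refine h.trans (mul_le_mul_of_nonneg_left ?_ (by positivity))
    exact mod_cast card_lineCrossings_le (V := V) (Y := Y) (L := L)

open Classical in
/-- Every incidence, but the last one on each line, starts a segment. -/
lemma card_incidences_le :
    ((V ×ˢ L).filter fun x => x.2.1 * x.1 + x.2.2 = Y x.1).card ≤
      (lineSegments V Y L).card + L.card := by
  set I := (V ×ˢ L).filter fun x => x.2.1 * x.1 + x.2.2 = Y x.1 with hI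
  have hmem : ∀ x, x ∈ I ↔ (x.1 ∈ V ∧ x.2 ∈ L) ∧ x.2.1 * x.1 + x.2.2 = Y x.1 := fun x => by
    rw [hI, Finset.mem_filter, Finset.mem_product]
  let Q : ℝ × (ℝ × ℝ) → Prop := fun x => ∃ w ∈ V, x.1 < w ∧ x.2.1 * w + x.2.2 = Y w
  have hnext : ∀ x, Q x → ∃ w ∈ V, x.1 < w ∧ x.2.1 * w + x.2.2 = Y w ∧
      ∀ v ∈ V, x.1 < v → v < w → x.2.1 * v + x.2.2 ≠ Y v := by
    rintro x ⟨w, hw, hxw, hYw⟩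
    obtain ⟨u, hu, hmin⟩ := (V.filter fun w => x.1 < w ∧ x.2.1 * w + x.2.2 = Y w
      ).exists_min_image id ⟨w, Finset.mem_filter.2 ⟨hw, hxw, hYw⟩⟩
    obtain ⟨hu1, hu2, hu3⟩ := Finset.mem_filter.1 hu
    exact ⟨u, hu1, hu2, hu3, fun v hv hxv hvu hYv =>
      (hmin v (Finset.mem_filter.2 ⟨hv, hxv, hYv⟩)).not_gt hvu⟩
  choose! φ hφ using hnext
  rw [← Finset.card_filter_add_card_filter_not (s := I) Q]
  refine add_le_add ?_ ?_
  · refine Finset.card_le_card_of_injOn (fun x => (x.2, (x.1, φ x))) (fun x hx => ?_)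
      fun x _ y _ hxy => ?_
    · obtain ⟨hxI, hxQ⟩ := Finset.mem_filter.1 hx
      obtain ⟨⟨hxV, hxL⟩, hxY⟩ := (hmem x).1 hxI
      obtain ⟨h1, h2, h3, h4⟩ := hφ x hxQ
      exact mem_lineSegments.2 ⟨⟨hxL, hxV, h1⟩, h2, hxY, h3, h4⟩
    · simp only [Prod.mk.injEq] at hxy
      exact Prod.ext hxy.2.1 hxy.1
  · refine Finset.card_le_card_of_injOn Prod.snd (fun x hx => ?_) fun x hx y hy hxy => ?_
    · exact ((hmem x).1 (Finset.mem_filter.1 hx).1).1.2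
    · obtain ⟨hxI, hxQ⟩ := Finset.mem_filter.1 hx
      obtain ⟨hyI, hyQ⟩ := Finset.mem_filter.1 hy
      have hx' := (hmem x).1 hxI
      have hy' := (hmem y).1 hyI
      refine Prod.ext (le_antisymm ?_ ?_) hxy
      · by_contra! hlt
        exact hyQ ⟨x.1, hx'.1.1, hlt, hxy ▸ hx'.2⟩
      · by_contra! hlt
        exact hxQ ⟨y.1, hy'.1.1, hlt, hxy ▸ hy'.2⟩

open Classical in
/-- The Szemerédi–Trotter bound for points with distinct abscissae and non-vertical lines. -/
lemma card_incidences_graph_le :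
    (((V ×ˢ L).filter fun x => x.2.1 * x.1 + x.2.2 = Y x.1).card : ℝ) ≤
      6 * ((V.card : ℝ) ^ ((2 : ℝ) / 3) * (L.card : ℝ) ^ ((2 : ℝ) / 3) + V.card + L.card) := by
  have h1 : (((V ×ˢ L).filter fun x => x.2.1 * x.1 + x.2.2 = Y x.1).card : ℝ) ≤
      (lineSegments V Y L).card + L.card := mod_cast card_incidences_le
  have hrpow : ∀ n : ℕ, ((n : ℝ) ^ ((2 : ℝ) / 3)) ^ 3 = (n : ℝ) ^ 2 := fun n => by
    rw [← Real.rpow_natCast, ← Real.rpow_mul (Nat.cast_nonneg n)]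
    norm_num
  have hV : (0 : ℝ) ≤ V.card := Nat.cast_nonneg _
  have hL : (0 : ℝ) ≤ L.card := Nat.cast_nonneg _
  have hVL : (0 : ℝ) ≤ (V.card : ℝ) ^ ((2 : ℝ) / 3) * (L.card : ℝ) ^ ((2 : ℝ) / 3) := by
    positivity
  rcases card_lineSegments_le_or (V := V) (Y := Y) (L := L) with h | h
  · linarith
  · have h2 : ((lineSegments V Y L).card : ℝ) ≤
        6 * ((V.card : ℝ) ^ ((2 : ℝ) / 3) * (L.card : ℝ) ^ ((2 : ℝ) / 3)) := by
      refine le_of_pow_le_pow_left₀ three_ne_zero (by positivity) (h.trans ?_)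
      rw [mul_pow, mul_pow, hrpow, hrpow]
      nlinarith [mul_nonneg (sq_nonneg (V.card : ℝ)) (sq_nonneg (L.card : ℝ))]
    linarith

end Lines

/-- A line in the plane is the zero set of an affine equation read off from a direction vector. -/
lemma AffineSubspace.exists_mem_iff_of_finrank_direction_eq_one
    {l : AffineSubspace ℝ (ℝ × ℝ)} (hl : Module.finrank ℝ l.direction = 1) :
    ∃ q d : ℝ × ℝ, d ≠ 0 ∧ ∀ p : ℝ × ℝ, p ∈ l ↔ (p.1 - q.1) * d.2 = (p.2 - q.2) * d.1 := by
  have hne : (l : Set (ℝ × ℝ)).Nonempty := by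
    rw [Set.nonempty_iff_ne_empty]
    intro h
    rw [AffineSubspace.coe_eq_bot_iff] at h
    rw [h, AffineSubspace.direction_bot, finrank_bot] at hl
    exact zero_ne_one hl
  obtain ⟨q, hq⟩ := hne
  obtain ⟨⟨d, hd⟩, hd0, hspan⟩ := finrank_eq_one_iff'.1 hl
  have hd0' : d ≠ 0 := fun h => hd0 (Subtype.ext h)
  refine ⟨q, d, hd0', fun p => ?_⟩
  rw [← AffineSubspace.vsub_right_mem_direction_iff_mem hq, vsub_eq_sub]
  constructor
  · intro hp
    obtain ⟨k, hk⟩ := hspan ⟨p - q, hp⟩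
    have h1 : k * d.1 = p.1 - q.1 := congrArg (fun v => v.1.1) hk
    have h2 : k * d.2 = p.2 - q.2 := congrArg (fun v => v.1.2) hk
    rw [← h1, ← h2]
    ring
  · intro hp
    by_cases h1 : d.1 = 0
    · have h2 : d.2 ≠ 0 := fun h2 => hd0' (Prod.ext h1 h2)
      have : p - q = ((p.2 - q.2) / d.2) • d := by
        rw [h1, mul_zero] at hp
        have h3 := (mul_eq_zero.1 hp).resolve_right h2
        ext
        · simp [h1, h3]
        · simp [h2]
      rw [this]
      exact l.direction.smul_mem _ hd
    · have : p - q = ((p.1 - q.1) / d.1) • d := by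
        ext
        · simp [h1]
        · simp only [Prod.snd_sub, Prod.smul_snd, smul_eq_mul]
          field_simp
          linarith
      rw [this]
      exact l.direction.smul_mem _ hd

/-- Some linear form `x + t * y` vanishes on none of finitely many nonzero vectors. -/
lemma exists_forall_add_mul_ne_zero (D : Finset (ℝ × ℝ)) (hD : ∀ d ∈ D, d ≠ 0) :
    ∃ t : ℝ, ∀ d ∈ D, d.1 + t * d.2 ≠ 0 := by
  obtain ⟨t, ht⟩ := Infinite.exists_notMem_finset (D.image fun d => -d.1 / d.2)
  refine ⟨t, fun d hd h0 => ?_⟩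
  by_cases h2 : d.2 = 0
  · exact hD d hd (Prod.ext (by simpa [h2] using h0) h2)
  · refine ht (Finset.mem_image.2 ⟨d, hd, ?_⟩)
    rw [div_eq_iff h2]
    linarith

/-- The Szemerédi–Trotter theorem: `m` points and `n` lines in the plane determine
`O(m^{2/3}n^{2/3} + m + n)` incidences. -/
theorem szemeredi_trotter :
    ∃ C : ℝ, 0 < C ∧
      ∀ (P : Finset (ℝ × ℝ)) (L : Finset (AffineSubspace ℝ (ℝ × ℝ))) (m n : ℕ),
        P.card = m → L.card = n →
        (∀ l ∈ L, Module.finrank ℝ l.direction = 1) →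
        (Set.ncard {x : (ℝ × ℝ) × AffineSubspace ℝ (ℝ × ℝ) |
            x.1 ∈ P ∧ x.2 ∈ L ∧ x.1 ∈ x.2} : ℝ) ≤
          C * ((m : ℝ) ^ ((2 : ℝ) / 3) * (n : ℝ) ^ ((2 : ℝ) / 3) + (m : ℝ) + (n : ℝ)) := by
  classical
  refine ⟨6, by norm_num, ?_⟩
  rintro P L _ _ rfl rfl hL
  choose! q d hd hmem using fun l hl =>
    AffineSubspace.exists_mem_iff_of_finrank_direction_eq_one (hL l hl)
  obtain ⟨t, ht⟩ := exists_forall_add_mul_ne_zero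
    (L.image d ∪ P.offDiag.image fun x => x.1 - x.2) fun v hv => by
      rcases Finset.mem_union.1 hv with hv | hv
      · obtain ⟨l, hl, rfl⟩ := Finset.mem_image.1 hv
        exact hd l hl
      · obtain ⟨x, hx, rfl⟩ := Finset.mem_image.1 hv
        exact sub_ne_zero.2 (Finset.mem_offDiag.1 hx).2.2
  have hdir : ∀ l ∈ L, (d l).1 + t * (d l).2 ≠ 0 := fun l hl =>
    ht _ (Finset.mem_union_left _ (Finset.mem_image_of_mem d hl))
  let X : ℝ × ℝ → ℝ := fun p => p.1 + t * p.2
  have hX : Set.InjOn X P := by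
    intro a ha b hb hab
    by_contra hne
    refine ht (a - b) (Finset.mem_union_right _ (Finset.mem_image.2
      ⟨(a, b), Finset.mem_offDiag.2 ⟨ha, hb, hne⟩, rfl⟩)) ?_
    simp only [X] at hab
    simp only [Prod.fst_sub, Prod.snd_sub]
    linarith
  let slope : AffineSubspace ℝ (ℝ × ℝ) → ℝ := fun l => (d l).2 / ((d l).1 + t * (d l).2)
  let σ : AffineSubspace ℝ (ℝ × ℝ) → ℝ × ℝ := fun l => (slope l, (q l).2 - slope l * X (q l))
  have hσ : ∀ l ∈ L, ∀ p, p ∈ l ↔ (σ l).1 * X p + (σ l).2 = p.2 := by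
    intro l hl p
    have h0 := hdir l hl
    have h1 : (σ l).1 * X p + (σ l).2 - p.2 =
        ((p.1 - (q l).1) * (d l).2 - (p.2 - (q l).2) * (d l).1) /
          ((d l).1 + t * (d l).2) := by
      have hs : slope l * ((d l).1 + t * (d l).2) = (d l).2 := div_mul_cancel₀ _ h0
      rw [eq_div_iff h0]
      simp only [σ, X]
      linear_combination (X p - X (q l)) * hs
    rw [hmem l hl p, ← sub_eq_zero, ← sub_eq_zero (b := p.2), h1, div_eq_zero_iff,
      or_iff_left h0]
  have hσL : Set.InjOn σ L := by
    intro a ha b hb hab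
    ext p
    rw [hσ a ha, hσ b hb, hab]
  let Y : ℝ → ℝ := fun v => (Function.invFunOn X P v).2
  have hY : ∀ p ∈ P, Y (X p) = p.2 := fun p hp =>
    congrArg Prod.snd (hX.leftInvOn_invFunOn (Finset.mem_coe.2 hp))
  have hbound := card_incidences_graph_le (V := P.image X) (Y := Y) (L := L.image σ)
  rw [Finset.card_image_of_injOn hX, Finset.card_image_of_injOn hσL] at hbound
  refine le_trans ?_ hbound
  rw [← Set.ncard_coe_finset]
  refine Nat.cast_le.2 (Set.ncard_le_ncard_of_injOn (fun x => (X x.1, σ x.2)) ?_ ?_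
    (Finset.finite_toSet _))
  · rintro ⟨p, l⟩ ⟨hp, hl, hpl⟩
    refine Finset.mem_coe.2 (Finset.mem_filter.2 ⟨Finset.mem_product.2
      ⟨Finset.mem_image_of_mem X hp, Finset.mem_image_of_mem σ hl⟩, ?_⟩)
    exact ((hσ l hl p).1 hpl).trans (hY p hp).symm
  · rintro ⟨p, l⟩ ⟨hp, hl, -⟩ ⟨p', l'⟩ ⟨hp', hl', -⟩ h
    obtain ⟨h1, h2⟩ := Prod.mk.inj h
    exact Prod.ext (hX hp hp' h1) (hσL hl hl' h2)
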